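/- Let n ≥ 3 and let α′ ∈ L_n not be the least element of L_n. Assume there is no divisor m of n with 2 ≤ m < n and fundamental g ∈ L_m such that α′ = g ⋆ λ, where λ is the least element of L_{n/m}. Suppose there is an odd index of α′ at which applying the applicable elementary operation (E_s or E_c) yields a lexical sequence; let i be the largest such odd index and let α be the result of applying that operation at cell i (α is obtained by applying one elementary operation on the tail of the longest left sequence of odd length which gives a lexical preceding). Then α ∈ L_n and α is adjacent to α′ in L_n with α < α′. -/

import Mathlib

/-!
Common definitions: α-sequences, the lexical order, elementary operations,
lexical sequences, harmonics, star products, etc.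
-/

/-- The sign-alternating sequence `Al(τ)` associated to an α-sequence `τ`
(0-indexed: entry `i` of `Al τ` is `(-1)^i * τ_{i+1}`, and `0` beyond the length). -/
def Al (τ : List ℕ) (i : ℕ) : ℤ := (-1 : ℤ) ^ i * (τ.getD i 0 : ℤ)

/-- The (strict) lexical order: `τ < τ'` iff the first nonzero entry of
`Al τ - Al τ'` is negative. -/
def lexLt (τ τ' : List ℕ) : Prop :=
  ∃ i, (∀ j < i, Al τ j = Al τ' j) ∧ Al τ i < Al τ' i

/-- An α-sequence: a nonempty finite sequence of positive integers. -/
def IsAlphaSeq (α : List ℕ) : Prop := α ≠ [] ∧ ∀ x ∈ α, 0 < x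

/-- `Aset n` is the set `A_n` of α-sequences of degree `n`. -/
def Aset (n : ℕ) : Set (List ℕ) := {α | IsAlphaSeq α ∧ α.sum = n}

/-- Splitting operation `E_s` at the (1-indexed) cell `i`:
`(α₁,…,α_{i-1}, α_i - 1, 1, α_{i+1},…,α_k)`. -/
def applyEs (α : List ℕ) (i : ℕ) : List ℕ :=
  α.take (i - 1) ++ [α.getD (i - 1) 0 - 1, 1] ++ α.drop i

/-- `E_s` is applicable at cell `i` iff `1 ≤ i ≤ l(α)` and `α_i > 1`. -/
def EsApplicable (α : List ℕ) (i : ℕ) : Prop :=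
  1 ≤ i ∧ i ≤ α.length ∧ 1 < α.getD (i - 1) 0

/-- Conjugation operation `E_c` at the (1-indexed) cell `i`:
`(α₁,…,α_{i-2}, α_{i-1} + 1, α_{i+1},…,α_k)`. -/
def applyEc (α : List ℕ) (i : ℕ) : List ℕ :=
  α.take (i - 2) ++ [α.getD (i - 2) 0 + 1] ++ α.drop i

/-- `E_c` is applicable at cell `i` iff `2 ≤ i ≤ l(α)` and `α_i = 1`. -/
def EcApplicable (α : List ℕ) (i : ℕ) : Prop :=
  2 ≤ i ∧ i ≤ α.length ∧ α.getD (i - 1) 0 = 1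

/-- `α'` is obtained from `α` by applying one elementary operation (`E_s` or `E_c`)
at the (1-indexed) cell `i`. -/
def ElemOpAt (α : List ℕ) (i : ℕ) (α' : List ℕ) : Prop :=
  (EsApplicable α i ∧ α' = applyEs α i) ∨ (EcApplicable α i ∧ α' = applyEc α i)

/-- `a < b` and `a`, `b` are adjacent in `S`: no element of `S` lies strictly between. -/
def AdjLtIn (S : Set (List ℕ)) (a b : List ℕ) : Prop :=
  lexLt a b ∧ ∀ γ ∈ S, ¬ (lexLt a γ ∧ lexLt γ b)

/-- An α-sequence is lexical iff it strictly exceeds all of its proper right sequences. -/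
def IsLexical (α : List ℕ) : Prop :=
  IsAlphaSeq α ∧ ∀ i, 2 ≤ i → i ≤ α.length → lexLt (α.drop (i - 1)) α

/-- `Lset n` is the set `L_n` of lexical sequences `α` with `1 + D(α) = n`. -/
def Lset (n : ℕ) : Set (List ℕ) := {α | IsLexical α ∧ 1 + α.sum = n}

/-- Add `1` to the last entry of a list. -/
def bumpLast (α : List ℕ) : List ℕ := α.dropLast ++ [α.getD (α.length - 1) 0 + 1]

/-- `α_e`: the even-length modification of `α`. -/
def seqE (α : List ℕ) : List ℕ := if Even α.length then bumpLast α else α ++ [1]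

/-- `α_o`: the odd-length modification of `α`. -/
def seqO (α : List ℕ) : List ℕ := if Even α.length then α ++ [1] else bumpLast α

/-- The `j`-th harmonicSeq: `h_0(α) = α` and `h_j(α) = (h_{j-1}(α))_o h_{j-1}(α)`. -/
def harmonicSeq : ℕ → List ℕ → List ℕ
  | 0, α => α
  | j + 1, α => seqO (harmonicSeq j α) ++ harmonicSeq j α

/-- A sequence is fundamental iff it is not a harmonicSeq `h_j(β)`, `j ≥ 1`,
of any α-sequence `β`. -/
def IsFundamental (α : List ℕ) : Prop :=
  ∀ β : List ℕ, IsAlphaSeq β → ∀ j, 1 ≤ j → α ≠ harmonicSeq j β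

/-- `α^q`: the `q`-fold concatenation of `α` with itself. -/
def nrep (α : List ℕ) (q : ℕ) : List ℕ := (List.replicate q α).flatten

/-- The star product
`α ⋆ β = α_o (α_e)^{β₁-1} α_o (α_e)^{β₂-1} ⋯ α_o (α_e)^{β_k-1} α`. -/
def starProd (α β : List ℕ) : List ℕ :=
  (β.map (fun b => seqO α ++ nrep (seqE α) (b - 1))).flatten ++ α

/-- `α ∧ β`: the longest common left factor, ended by the minimum of the
first differing entries. -/
def wedge : List ℕ → List ℕ → List ℕ
  | [], _ => []
  | _, [] => []
  | a :: as, b :: bs => if a = b then a :: wedge as bs else [min a b]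

/-- `a` is the least element of `S` in the lexical order. -/
def LeastIn (S : Set (List ℕ)) (a : List ℕ) : Prop :=
  a ∈ S ∧ ∀ b ∈ S, b ≠ a → lexLt a b

/-- `a` is the greatest element of `S` in the lexical order. -/
def GreatestIn (S : Set (List ℕ)) (a : List ℕ) : Prop :=
  a ∈ S ∧ ∀ b ∈ S, b ≠ a → lexLt b a

/-- `i` is an even (1-indexed) cell of `α` at which the applicable elementary
operation yields a lexical sequence. -/
def GoodEvenIndex (α : List ℕ) (i : ℕ) : Prop :=
  Even i ∧ ∃ α', ElemOpAt α i α' ∧ IsLexical α'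

/-- `i` is an odd (1-indexed) cell of `α` at which the applicable elementary
operation yields a lexical sequence. -/
def GoodOddIndex (α : List ℕ) (i : ℕ) : Prop :=
  Odd i ∧ ∃ α', ElemOpAt α i α' ∧ IsLexical α'

/-- The successor operation: apply whichever of `E_s`, `E_c` is applicable at
the largest even (1-indexed) index `≤ l(α)`, i.e. on the tail of the longest
left sequence of even length. -/
def succOp (α : List ℕ) : List ℕ :=
  let i := if Even α.length then α.length else α.length - 1
  if 1 < α.getD (i - 1) 0 then applyEs α i else applyEc α i

/-- First-difference order on integer sequences. -/
def SeqLt (a b : ℕ → ℤ) : Prop := ∃ k, (∀ i < k, a i = b i) ∧ a k < b k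

theorem SeqLt.trans {a b c : ℕ → ℤ} (h₁ : SeqLt a b) (h₂ : SeqLt b c) : SeqLt a c := by
  obtain ⟨k, hk, hk'⟩ := h₁
  obtain ⟨l, hl, hl'⟩ := h₂
  rcases lt_trichotomy k l with h | h | h
  · exact ⟨k, fun i hi => (hk i hi).trans (hl i (hi.trans h)), (hl k h) ▸ hk'⟩
  · subst h
    exact ⟨k, fun i hi => (hk i hi).trans (hl i hi), hk'.trans hl'⟩
  · exact ⟨l, fun i hi => (hk i (hi.trans h)).trans (hl i hi), (hk l h).symm ▸ hl'⟩

theorem SeqLt.irrefl (a : ℕ → ℤ) : ¬ SeqLt a a := fun ⟨_, _, h⟩ => lt_irrefl _ h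

theorem SeqLt.asymm {a b : ℕ → ℤ} (h₁ : SeqLt a b) : ¬ SeqLt b a :=
  fun h₂ => SeqLt.irrefl a (h₁.trans h₂)

theorem SeqLt.eq_or_lt_of_not_lt {a b : ℕ → ℤ} (h : ¬ SeqLt a b) : a = b ∨ SeqLt b a := by
  classical
  by_cases hab : a = b
  · exact Or.inl hab
  · right
    have hex : ∃ k, a k ≠ b k := Function.ne_iff.mp hab
    have hmin : ∀ i < Nat.find hex, a i = b i := fun i hi => not_not.mp (Nat.find_min hex hi)
    rcases lt_or_gt_of_ne (Nat.find_spec hex) with h' | h'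
    · exact absurd ⟨_, hmin, h'⟩ h
    · exact ⟨_, fun i hi => (hmin i hi).symm, h'⟩

theorem SeqLt.eq_of_squeeze {a b c : ℕ → ℤ} {m : ℕ} (h₁ : SeqLt a b) (h₂ : SeqLt b c)
    (hac : ∀ i ≤ m, a i = c i) : ∀ i ≤ m, a i = b i := by
  obtain ⟨k, hk, hk'⟩ := h₁
  obtain ⟨l, hl, hl'⟩ := h₂
  intro i hi
  by_cases hkm : k ≤ m
  · exfalso
    rcases lt_trichotomy k l with h | h | h
    · have h1 := hac k hkm
      have h2 := hl k h
      omega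
    · subst h
      have h1 := hac k hkm
      omega
    · have h1 := hac l (by omega)
      have h2 := hk l h
      omega
  · exact hk i (by omega)

/-- The shift of `X` by `j`, with sign normalized so that it starts with `-1` if `X j = ±1`. -/
def normShift (X : ℕ → ℤ) (j k : ℕ) : ℤ := -X j * X (j + k)

/-- Sign words of length `n - 1`, preceded by `-1` and followed by zeros, each of whose
normalized shifts is smaller than the word itself. -/
structure Admissible (n : ℕ) (X : ℕ → ℤ) : Prop where
  zero : X 0 = -1
  one : X 1 = 1
  sign : ∀ k < n, X k = 1 ∨ X k = -1
  tail : ∀ k, n ≤ k → X k = 0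
  shift_lt : ∀ j, 0 < j → j < n → SeqLt (normShift X j) X

/-- Negate all entries from position `q` on. -/
def flipFrom (q : ℕ) (X : ℕ → ℤ) (k : ℕ) : ℤ := if k < q then X k else -X k

theorem flipFrom_of_lt {q k : ℕ} (X : ℕ → ℤ) (h : k < q) : flipFrom q X k = X k := if_pos h

theorem flipFrom_of_le {q k : ℕ} (X : ℕ → ℤ) (h : q ≤ k) : flipFrom q X k = -X k :=
  if_neg (by omega)

theorem Admissible.lt_of_ne_zero {n : ℕ} {X : ℕ → ℤ} (hX : Admissible n X) {k : ℕ}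
    (h : X k ≠ 0) : k < n := by
  by_contra hk
  exact h (hX.tail k (by omega))

theorem Admissible.two_eq_one {n : ℕ} {X : ℕ → ℤ} (hX : Admissible n X) {j : ℕ} (hj : 0 < j)
    (h₀ : X j = 1) (h₁ : X (j + 1) = 1) : X 2 = 1 := by
  by_contra h2
  have hjn : j + 1 < n := hX.lt_of_ne_zero (by omega)
  have halt : ∀ i, i + 2 < n → X (i + 2) = -X (i + 1) := by
    intro i
    induction i with
    | zero =>
      intro hi
      have := hX.sign 2 hi
      have := hX.one
      simp only [zero_add]
      omega
    | succ i ih =>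
      intro hi
      have hi' := ih (by omega)
      by_contra hne
      have hs := hX.shift_lt (i + 1) (by omega) (by omega)
      refine hs.asymm ⟨2, ?_, ?_⟩
      · intro k hk
        have s1 := hX.sign (i + 1) (by omega)
        interval_cases k
        · rcases s1 with h | h <;> simp [normShift, h, hX.zero]
        · have : i + 1 + 1 = i + 2 := by omega
          rcases s1 with h | h <;> simp [normShift, this, hi', h, hX.one]
      · have s1 := hX.sign (i + 1) (by omega)
        have s2 := hX.sign 2 (by omega)
        have s3 := hX.sign (i + 1 + 2) (by omega)
        have h3 : X (i + 1 + 2) = X (i + 2) := by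
          have hne' : X (i + 3) ≠ -X (i + 2) := hne
          rw [show i + 1 + 2 = i + 3 by omega] at s3 ⊢
          rcases s1 with h | h <;> omega
        have h4 : X 2 = -1 := by omega
        rcases s1 with h | h <;> simp [normShift, h3, hi', h, h4]
  obtain ⟨i, rfl⟩ := Nat.exists_eq_succ_of_ne_zero hj.ne'
  have := halt i hjn
  simp only [Nat.succ_eq_add_one] at h₀ h₁
  have h5 : i + 1 + 1 = i + 2 := by omega
  rw [h5] at h₁
  omega

/-- If `X > Z > Y` are admissible with `Y` obtained by flipping `X` from `p` on, the first position
after `p` where `X` and `Z` change their relative sign is one where `X` is positive. -/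
theorem exists_first_switch {n p : ℕ} {X Z : ℕ → ℤ} (hX : Admissible n X) (hZ : Admissible n Z)
    (hp : 2 ≤ p) (hXp : X p = 1) (hYZ : SeqLt (flipFrom p X) Z) (hZX : SeqLt Z X)
    (hZp : ∀ k < p, Z k = X k) :
    ∃ r, p < r ∧ r < n ∧ X r * Z r ≠ X (r - 1) * Z (r - 1) ∧ X r = 1 ∧
      ∀ i, 0 < i → i < r → X i * Z i ≠ X (i - 1) * Z (i - 1) → X i = 1 := by
  obtain ⟨k₁, h₁, h₁'⟩ := hZX
  have hk₁n : k₁ < n := by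
    by_contra h
    rw [hX.tail _ (by omega), hZ.tail _ (by omega)] at h₁'
    omega
  have hsX := hX.sign k₁ hk₁n
  have hsZ := hZ.sign k₁ hk₁n
  have hpk : p ≤ k₁ := by
    by_contra h
    have := hZp k₁ (by omega)
    omega
  have hsq : ∀ k < n, X k * X k = 1 := by
    intro k hk
    rcases hX.sign k hk with h | h <;> simp [h]
  have hX1 : X k₁ = 1 := by omega
  have hZ1 : Z k₁ = -1 := by omega
  rcases hpk.lt_or_eq with hpk | rfl
  · refine ⟨k₁, hpk, hk₁n, ?_, hX1, ?_⟩
    · rw [hX1, hZ1, h₁ _ (by omega), hsq _ (by omega)]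
      decide
    · intro i hi0 hi hne
      rw [h₁ _ hi, h₁ _ (by omega), hsq _ (by omega), hsq _ (by omega)] at hne
      exact absurd rfl hne
  · obtain ⟨k₂, h₂, h₂'⟩ := hYZ
    have hk₂n : k₂ < n := by
      by_contra h
      rw [flipFrom_of_le X (by omega), hX.tail _ (by omega), hZ.tail _ (by omega)] at h₂'
      omega
    have hpk₂ : p < k₂ := by
      by_contra h
      rcases (not_lt.mp h).lt_or_eq with h | rfl
      · rw [flipFrom_of_lt X h, hZp _ h] at h₂'
        omega
      · rw [flipFrom_of_le X le_rfl] at h₂'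
        omega
    have hmid : ∀ k, p ≤ k → k < k₂ → Z k = -X k := by
      intro k hk hk'
      rw [← h₂ k hk', flipFrom_of_le X hk]
    rw [flipFrom_of_le X hpk₂.le] at h₂'
    have s1 := hX.sign k₂ hk₂n
    have s2 := hZ.sign k₂ hk₂n
    have hX2 : X k₂ = 1 := by omega
    have hZ2 : Z k₂ = 1 := by omega
    refine ⟨k₂, hpk₂, hk₂n, ?_, hX2, ?_⟩
    · rw [hX2, hZ2, hmid _ (by omega) (by omega), mul_neg, hsq _ (by omega)]
      decide
    · intro i hi0 hi hne
      rcases lt_trichotomy i p with h | h | h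
      · rw [hZp _ h, hZp _ (by omega), hsq _ (by omega), hsq _ (by omega)] at hne
        exact absurd rfl hne
      · rw [h, hXp]
      · rw [hmid i h.le hi, hmid (i - 1) (by omega) (by omega), mul_neg, mul_neg,
          hsq _ (by omega), hsq _ (by omega)] at hne
        exact absurd rfl hne

/-- If flipping `X` at the end `q` of a positive run is not admissible, while flipping it at some
`p < q` is, then some shift of `X` by `j ∈ [p, q)` has the negative of the beginning of `X`
as prefix up to `q`. -/
theorem exists_overlap_of_not_admissible {n p q : ℕ} {X : ℕ → ℤ} (hX : Admissible n X)
    (hY : Admissible n (flipFrom p X)) (hp : 2 ≤ p) (hXp : X p = 1) (hpq : p < q)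
    (hXq : X q = 1) (hW : ¬ Admissible n (flipFrom q X)) :
    ∃ j, p ≤ j ∧ j < q ∧ q - j ≤ p ∧ X j = 1 ∧ (∀ k < q - j, X k = -X (j + k)) ∧
      SeqLt (flipFrom q X) (normShift (flipFrom q X) j) := by
  have hbad : ∃ j, 0 < j ∧ j < n ∧
      ¬ SeqLt (normShift (flipFrom q X) j) (flipFrom q X) := by
    by_contra hcon
    push Not at hcon
    refine hW ⟨?_, ?_, ?_, ?_, hcon⟩
    · rw [flipFrom_of_lt X (by omega), hX.zero]
    · rw [flipFrom_of_lt X (by omega), hX.one]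
    · intro k hk
      have := hX.sign k hk
      unfold flipFrom
      split <;> omega
    · intro k hk
      have := hX.tail k hk
      unfold flipFrom
      split <;> omega
  obtain ⟨j, hj0, hjn, hnot⟩ := hbad
  have hlt : SeqLt (flipFrom q X) (normShift (flipFrom q X) j) := by
    rcases SeqLt.eq_or_lt_of_not_lt hnot with h | h
    · exfalso
      have h1 := congrFun h (n - j)
      rw [normShift] at h1
      have h2 : flipFrom q X (j + (n - j)) = 0 := by
        have := hX.tail (j + (n - j)) (by omega)
        unfold flipFrom
        split <;> omega
      have h3 := hX.sign (n - j) (by omega)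
      rw [h2, mul_zero] at h1
      unfold flipFrom at h1
      split at h1 <;> omega
    · exact h
  have hjq : j < q := by
    by_contra hjq
    have hT := hY.shift_lt j hj0 hjn
    have heq : normShift (flipFrom q X) j = normShift (flipFrom p X) j := by
      funext k
      rw [normShift, normShift, flipFrom_of_le X (by omega), flipFrom_of_le X (by omega),
        flipFrom_of_le X (by omega), flipFrom_of_le X (by omega)]
    rw [heq] at hlt
    refine (hlt.trans hT).asymm ⟨p, ?_, ?_⟩
    · intro i hi
      rw [flipFrom_of_lt X hi, flipFrom_of_lt X (by omega)]
    · rw [flipFrom_of_le X le_rfl, flipFrom_of_lt X hpq, hXp]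
      decide
  obtain ⟨k₀, hk₀, hk₀'⟩ := id hlt
  simp only [normShift] at hk₀ hk₀'
  have hWj : flipFrom q X j = X j := flipFrom_of_lt X hjq
  have hTX := hX.shift_lt j hj0 hjn
  have hk₀q : q - j ≤ k₀ := by
    by_contra h
    refine hTX.asymm ⟨k₀, ?_, ?_⟩
    · intro i hi
      have := hk₀ i hi
      rwa [hWj, flipFrom_of_lt X (by omega), flipFrom_of_lt X (by omega)] at this
    · rwa [hWj, flipFrom_of_lt X (by omega), flipFrom_of_lt X (by omega)] at hk₀'
  have hpre : ∀ k < q - j, X k = -X j * X (j + k) := by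
    intro k hk
    have := hk₀ k (by omega)
    rwa [hWj, flipFrom_of_lt X (by omega), flipFrom_of_lt X (by omega)] at this
  have hXj : X j = 1 := by
    rcases hX.sign j (by omega) with h | h
    · exact h
    · exfalso
      have hle : flipFrom q X (q - j) ≤ -flipFrom q X j * flipFrom q X (j + (q - j)) := by
        rcases hk₀q.lt_or_eq with h' | h'
        · exact (hk₀ _ h').le
        · rw [h']
          exact hk₀'.le
      have hjj : j + (q - j) = q := by omega
      rw [hWj, hjj, flipFrom_of_lt X (by omega), flipFrom_of_le X le_rfl, hXq, h] at hle
      refine hTX.asymm ⟨q - j, hpre, ?_⟩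
      rw [normShift]
      rw [hjj, hXq, h]
      omega
  have hpre' : ∀ k < q - j, X k = -X (j + k) := by
    intro k hk
    rw [hpre k hk, hXj]
    ring
  have hpj : p ≤ j := by
    by_contra hpj
    have h1 : X (p - j) = -1 := by
      have := hpre' (p - j) (by omega)
      rw [show j + (p - j) = p by omega, hXp] at this
      exact this
    refine (hY.shift_lt j hj0 hjn).asymm ⟨p - j, ?_, ?_⟩
    · intro k hk
      rw [normShift, flipFrom_of_lt X (by omega), flipFrom_of_lt X (by omega),
        flipFrom_of_lt X (by omega), hpre k (by omega)]
    · rw [normShift]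
      rw [flipFrom_of_lt X (by omega), flipFrom_of_lt X (by omega), flipFrom_of_le X (by omega),
        show j + (p - j) = p by omega, hXp, h1, hXj]
      decide
  refine ⟨j, hpj, hjq, ?_, hXj, hpre', hlt⟩
  by_contra hcon
  refine (hY.shift_lt j hj0 hjn).asymm ⟨p, ?_, ?_⟩
  · intro k hk
    rw [normShift, flipFrom_of_lt X (by omega), flipFrom_of_le X (by omega),
      flipFrom_of_le X (by omega), hpre k (by omega)]
    ring
  · rw [normShift]
    rw [flipFrom_of_le X le_rfl, flipFrom_of_le X (by omega), flipFrom_of_le X (by omega),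
      hXj, hXp]
    have := hpre' p (by omega)
    omega

/-- The relative sign of `X` and `Z` is constant on an interval without a switch. -/
theorem relSign_const {X Z : ℕ → ℤ} {a b : ℕ}
    (h : ∀ i, a < i → i < b → X i * Z i = X (i - 1) * Z (i - 1)) :
    ∀ i, a ≤ i → i < b → X i * Z i = X a * Z a := by
  intro i hai
  induction i, hai using Nat.le_induction with
  | base => exact fun _ => rfl
  | succ i hi ih =>
    intro hib
    rw [h (i + 1) (by omega) hib, Nat.add_sub_cancel, ih (by omega)]

theorem neg_mul_of_mul_eq {x z w : ℤ} (hz : z = 1 ∨ z = -1) (h : x * z = w) : -w * z = -x := by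
  subst h
  rcases hz with rfl | rfl <;> ring

theorem neg_mul_of_mul_ne {x z w : ℤ} (hx : x = 1 ∨ x = -1) (hz : z = 1 ∨ z = -1)
    (hw : w = 1 ∨ w = -1) (h : x * z ≠ w) : -w * z = x := by
  rcases hx with rfl | rfl <;> rcases hz with rfl | rfl <;> rcases hw with rfl | rfl <;>
    first | rfl | exact absurd rfl h

/-- After a switch at which no later flip is admissible there is another switch of the same kind. -/
theorem exists_next_switch {n p r : ℕ} {X Z : ℕ → ℤ} (hX : Admissible n X)
    (hY : Admissible n (flipFrom p X)) (hZ : Admissible n Z) (hp : 2 ≤ p) (hXp : X p = 1)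
    (hZX : SeqLt Z X) (hZp : ∀ k < p, Z k = X k)
    (hbad : ∀ q, p < q → q < n → X q = 1 → X (q + 1) ≠ 1 → ¬ Admissible n (flipFrom q X))
    (hpr : p < r) (hrn : r < n) (hsw : X r * Z r ≠ X (r - 1) * Z (r - 1)) (hXr : X r = 1)
    (hall : ∀ i, 0 < i → i < r → X i * Z i ≠ X (i - 1) * Z (i - 1) → X i = 1) :
    ∃ x, r < x ∧ x < n ∧ X x * Z x ≠ X (x - 1) * Z (x - 1) ∧ X x = 1 ∧
      ∀ i, 0 < i → i < x → X i * Z i ≠ X (i - 1) * Z (i - 1) → X i = 1 := by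
  classical
  -- the end `q` of the positive run of `X` through `r`
  obtain ⟨q, hrq, hrun, hend⟩ : ∃ q, r ≤ q ∧ (∀ i, r ≤ i → i ≤ q → X i = 1) ∧ X (q + 1) ≠ 1 := by
    have hex : ∃ q, r ≤ q ∧ X (q + 1) ≠ 1 :=
      ⟨n, by omega, by rw [hX.tail (n + 1) (by omega)]; decide⟩
    refine ⟨Nat.find hex, (Nat.find_spec hex).1, ?_, (Nat.find_spec hex).2⟩
    intro i hri hiq
    rcases hri.lt_or_eq with h | rfl
    · have := Nat.find_min hex (m := i - 1) (by omega)
      rw [show i - 1 + 1 = i by omega] at this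
      by_contra h'
      exact this ⟨by omega, h'⟩
    · exact hXr
  have hXq : X q = 1 := hrun q hrq le_rfl
  have hqn : q < n := hX.lt_of_ne_zero (by omega)
  obtain ⟨j, hpj, hjq, hqjp, hXj, hpre, hlt⟩ := exists_overlap_of_not_admissible hX hY hp hXp
    (hpr.trans_le hrq) hXq (hbad q (by omega) hqn hXq hend)
  have hsX : ∀ k < n, X k = 1 ∨ X k = -1 := hX.sign
  have hsZ : ∀ k < n, Z k = 1 ∨ Z k = -1 := hZ.sign
  have hV := hZ.shift_lt j (by omega) (by omega)
  -- there is no switch strictly between `j` and `q`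
  have hnosw : ∀ i, j < i → i < q → X i * Z i = X (i - 1) * Z (i - 1) := by
    by_contra hcon
    push Not at hcon
    have hspec := Nat.find_spec hcon
    have hmin : ∀ m < Nat.find hcon, j < m → X m * Z m = X (m - 1) * Z (m - 1) := by
      intro m hm hjm
      by_contra h
      exact Nat.find_min hcon hm ⟨hjm, hm.trans hspec.2.1, h⟩
    generalize Nat.find hcon = i at hspec hmin
    obtain ⟨hji, hiq, hne⟩ := hspec
    have hXi : X i = 1 := by
      by_cases hir : i < r
      · exact hall i (by omega) hir hne
      · exact hrun i (by omega) hiq.le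
    have hconst := relSign_const (X := X) (Z := Z) (a := j) (b := i)
      (fun m h1 h2 => hmin m h2 h1)
    rw [hXj, one_mul] at hconst
    have hXij : X (i - j) = -1 := by
      rw [hpre (i - j) (by omega), show j + (i - j) = i by omega, hXi]
    refine hV.asymm ⟨i - j, ?_, ?_⟩
    · intro k hk
      rw [normShift, neg_mul_of_mul_eq (hsZ _ (by omega)) (hconst (j + k) (by omega) (by omega)),
        ← hpre k (by omega), hZp k (by omega)]
    · rw [hconst (i - 1) (by omega) (by omega)] at hne
      rw [normShift, show j + (i - j) = i by omega,
        neg_mul_of_mul_ne (hsX _ (by omega)) (hsZ _ (by omega)) (hsZ _ (by omega)) hne,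
        hZp _ (by omega), hXi, hXij]
      decide
  have hWj : flipFrom q X j = 1 := by rw [flipFrom_of_lt X hjq, hXj]
  have hT : ∀ k, q ≤ j + k → normShift (flipFrom q X) j k = X (j + k) := by
    intro k hk
    rw [normShift, hWj, flipFrom_of_le X hk]
    ring
  have hT' : ∀ k, k < q - j → normShift (flipFrom q X) j k = X k := by
    intro k hk
    rw [normShift, hWj, flipFrom_of_lt X (by omega), hpre k hk]
    ring
  -- the run consists of `r` only
  have hqr : q = r := by
    by_contra hqr
    have hrj : r ≤ j := by
      by_contra h
      exact hsw (hnosw r (by omega) (by omega))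
    have hjq1 : q = j + 1 := by
      by_contra h
      have h1 := hpre 1 (by omega)
      rw [hX.one, hrun (j + 1) (by omega) (by omega)] at h1
      omega
    subst hjq1
    refine hlt.asymm ⟨2, ?_, ?_⟩
    · intro k hk
      interval_cases k
      · rw [hT' 0 (by omega), flipFrom_of_lt X (by omega)]
      · rw [hT 1 (by omega), flipFrom_of_lt X (by omega), hXq, hX.one]
    · rw [hT 2 (by omega), flipFrom_of_lt X (by omega), hX.two_eq_one (by omega) hXj hXq]
      by_cases h : j + 2 < n
      · have := hsX _ h
        have : j + 1 + 1 = j + 2 := rfl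
        rw [this] at hend
        omega
      · rw [hX.tail _ (by omega)]
        decide
  subst hqr
  have hconst := relSign_const hnosw
  rw [hXj, one_mul] at hconst
  have hZr : -Z j * Z q = 1 := by
    rw [hconst (q - 1) (by omega) (by omega)] at hsw
    rw [neg_mul_of_mul_ne (hsX _ hqn) (hsZ _ hqn) (hsZ _ (by omega)) hsw, hXq]
  have hZj : -Z j = Z q := by
    rcases hsZ q hqn with h | h <;> rw [h] at hZr ⊢ <;> omega
  have hVlow : ∀ k < q - j, normShift Z j k = X k := by
    intro k hk
    rw [normShift, neg_mul_of_mul_eq (hsZ _ (by omega)) (hconst (j + k) (by omega) (by omega)),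
      ← hpre k (by omega)]
  -- the next switch, or the end of the word
  obtain ⟨x, hqx, hxn, hx, hmin⟩ : ∃ x, q < x ∧ x ≤ n ∧
      (x = n ∨ X x * Z x ≠ X (x - 1) * Z (x - 1)) ∧
      ∀ i, q < i → i < x → X i * Z i = X (i - 1) * Z (i - 1) := by
    have hex : ∃ x, q < x ∧ (x = n ∨ X x * Z x ≠ X (x - 1) * Z (x - 1)) :=
      ⟨n, hqn, Or.inl rfl⟩
    refine ⟨Nat.find hex, (Nat.find_spec hex).1, Nat.find_min' hex ⟨hqn, Or.inl rfl⟩,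
      (Nat.find_spec hex).2, ?_⟩
    intro i hqi hi
    by_contra h
    exact Nat.find_min hex hi ⟨hqi, Or.inr h⟩
  have hconst' := relSign_const hmin
  rw [hXq, one_mul] at hconst'
  have hVT : ∀ k < x - j, normShift (flipFrom q X) j k = normShift Z j k := by
    intro k hk
    by_cases hkq : k < q - j
    · rw [hT' k hkq, hVlow k hkq]
    · have := neg_mul_of_mul_eq (hsZ _ (by omega)) (hconst' (j + k) (by omega) (by omega))
      rw [hT k (by omega), normShift, hZj]
      linarith
  obtain ⟨k₁, hk₁, hk₁'⟩ := id hZX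
  have hZW : k₁ < q → ¬ SeqLt (flipFrom q X) Z := by
    intro h
    refine SeqLt.asymm ⟨k₁, ?_, ?_⟩
    · intro i hi
      rw [hk₁ i hi, flipFrom_of_lt X (by omega)]
    · rwa [flipFrom_of_lt X h]
  have hZW' : ¬ k₁ < q → ∀ k < x, flipFrom q X k = Z k := by
    intro h k hk
    by_cases hkq : k < q
    · rw [flipFrom_of_lt X hkq, hk₁ k (by omega)]
    · rw [flipFrom_of_le X (by omega)]
      have h1 := hconst' k (by omega) hk
      have h2 := hk₁ (q - 1) (by omega)
      have h3 := hsX (q - 1) (by omega)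
      rw [hXq, h2, one_mul] at hsw
      have h4 : Z q = -1 := by
        have := hsZ q hqn
        rcases h3 with h3 | h3 <;> rw [h3] at hsw <;> omega
      rw [h4] at h1
      rcases hsX k (by omega) with h5 | h5 <;> rw [h5] at h1 ⊢ <;> omega
  have hxn' : x < n := by
    by_contra hxn'
    obtain rfl : x = n := by omega
    have hVT' : normShift (flipFrom q X) j = normShift Z j := by
      funext k
      by_cases hk : k < x - j
      · exact hVT k hk
      · rw [hT k (by omega), normShift, hX.tail (j + k) (by omega), hZ.tail (j + k) (by omega),
          mul_zero]
    rw [hVT'] at hlt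
    have hWZ := hlt.trans hV
    by_cases h : k₁ < q
    · exact hZW h hWZ
    · have hWZ' : flipFrom q X = Z := by
        funext k
        by_cases hk : k < x
        · exact hZW' h k hk
        · rw [flipFrom_of_le X (by omega), hX.tail _ (by omega), hZ.tail _ (by omega), neg_zero]
      rw [hWZ'] at hWZ
      exact SeqLt.irrefl _ hWZ
  have hxsw := hx.resolve_left hxn'.ne
  have hXx : X x = 1 := by
    by_contra hXx
    have hXx' : X x = -1 := (hsX x hxn').resolve_left hXx
    have hTx : normShift (flipFrom q X) j (x - j) = -1 := by
      rw [hT _ (by omega), show j + (x - j) = x by omega, hXx']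
    have hVx : normShift Z j (x - j) = 1 := by
      rw [hconst' (x - 1) (by omega) (by omega)] at hxsw
      have := neg_mul_of_mul_ne (hsX _ hxn') (hsZ _ hxn') (hsZ _ hqn) hxsw
      rw [normShift, show j + (x - j) = x by omega, hZj]
      linarith
    have hTV : SeqLt (normShift (flipFrom q X) j) (normShift Z j) :=
      ⟨x - j, hVT, by rw [hTx, hVx]; decide⟩
    by_cases h : k₁ < q
    · exact hZW h (hlt.trans (hTV.trans hV))
    · have hWZ : ∀ i ≤ x - j, flipFrom q X i = Z i := fun i hi => hZW' h i (by omega)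
      have h1 := hlt.eq_of_squeeze (hTV.trans hV) hWZ (x - j) le_rfl
      have h2 := (hlt.trans hTV).eq_of_squeeze hV hWZ (x - j) le_rfl
      omega
  refine ⟨x, hqx, hxn', hxsw, hXx, ?_⟩
  intro i hi hix hne
  rcases lt_trichotomy i q with h | h | h
  · exact hall i hi h hne
  · rw [h, hXq]
  · exact absurd (hmin i h hix) hne

/-- If an admissible word lies strictly between `X` and its flip at `p`, then `X` has an admissible
flip at the end of a positive run after `p`. -/
theorem exists_admissible_flip_of_between {n p : ℕ} {X Z : ℕ → ℤ} (hX : Admissible n X)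
    (hY : Admissible n (flipFrom p X)) (hZ : Admissible n Z) (hp : 0 < p) (hXp : X p = 1)
    (hYZ : SeqLt (flipFrom p X) Z) (hZX : SeqLt Z X) :
    ∃ q, p < q ∧ q < n ∧ X q = 1 ∧ X (q + 1) ≠ 1 ∧ Admissible n (flipFrom q X) := by
  by_contra hcon
  push Not at hcon
  have hp2 : 2 ≤ p := by
    by_contra h
    obtain rfl : p = 1 := by omega
    have := hY.one
    rw [flipFrom_of_le X le_rfl, hXp] at this
    omega
  have hZp : ∀ k < p, Z k = X k := by
    intro k hk
    have hYX : ∀ i ≤ p - 1, flipFrom p X i = X i := fun i hi => flipFrom_of_lt X (by omega)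
    rw [← hYZ.eq_of_squeeze hZX hYX k (by omega), hYX k (by omega)]
  have hno : ∀ d r, n - r = d → p < r → r < n → X r * Z r ≠ X (r - 1) * Z (r - 1) → X r = 1 →
      ¬ ∀ i, 0 < i → i < r → X i * Z i ≠ X (i - 1) * Z (i - 1) → X i = 1 := by
    intro d
    induction d using Nat.strong_induction_on with
    | _ d ih =>
      intro r hd hpr hrn hsw hXr hall
      obtain ⟨x, hrx, hxn, hxsw, hXx, hxall⟩ :=
        exists_next_switch hX hY hZ hp2 hXp hZX hZp hcon hpr hrn hsw hXr hall
      exact ih (n - x) (by omega) x rfl (hpr.trans hrx) hxn hxsw hXx hxall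
  obtain ⟨r, hpr, hrn, hsw, hXr, hall⟩ := exists_first_switch hX hZ hp2 hXp hYZ hZX hZp
  exact hno _ r rfl hpr hrn hsw hXr hall

/-- The sign word of a sequence: blocks of constant sign, alternating, starting with `s`. -/
def signWord : ℤ → List ℕ → List ℤ
  | _, [] => []
  | s, a :: l => List.replicate a s ++ signWord (-s) l

/-- The sign word starting with `-s`, preceded by one entry `s` and followed by zeros. -/
def signSeq (s : ℤ) (l : List ℕ) (k : ℕ) : ℤ := (s :: signWord (-s) l).getD k 0

theorem signSeq_zero (s : ℤ) (l : List ℕ) : signSeq s l 0 = s := rfl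

theorem signSeq_nil (s : ℤ) {k : ℕ} (hk : 0 < k) : signSeq s [] k = 0 := by
  obtain ⟨k, rfl⟩ := Nat.exists_eq_succ_of_ne_zero hk.ne'
  simp [signSeq, signWord]

theorem signSeq_cons_of_le (s : ℤ) {a : ℕ} (l : List ℕ) {k : ℕ} (hk : 0 < k) (hka : k ≤ a) :
    signSeq s (a :: l) k = -s := by
  obtain ⟨k, rfl⟩ := Nat.exists_eq_succ_of_ne_zero hk.ne'
  simp only [Nat.succ_eq_add_one] at *
  rw [signSeq, List.getD_cons_succ, signWord, List.getD_append _ _ _ _ (by simpa using hka),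
    List.getD_replicate _ (by omega)]

theorem signSeq_cons_add (s : ℤ) {a : ℕ} (l : List ℕ) (ha : 0 < a) (k : ℕ) :
    signSeq s (a :: l) (a + k) = signSeq (-s) l k := by
  cases k with
  | zero => rw [add_zero, signSeq_cons_of_le s l ha le_rfl, signSeq_zero]
  | succ k =>
    rw [signSeq, signSeq, ← add_assoc, List.getD_cons_succ, List.getD_cons_succ, signWord,
      List.getD_append_right _ _ _ _ (by simp)]
    simp

theorem cons_index_cases {a k : ℕ} : k = 0 ∨ (0 < k ∧ k ≤ a) ∨ ∃ m, 0 < m ∧ k = a + m := by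
  by_cases h0 : k = 0
  · exact Or.inl h0
  · by_cases h : k ≤ a
    · exact Or.inr (Or.inl ⟨by omega, h⟩)
    · exact Or.inr (Or.inr ⟨k - a, by omega, by omega⟩)

theorem signSeq_neg {l : List ℕ} (hl : ∀ x ∈ l, 0 < x) (s : ℤ) (k : ℕ) :
    signSeq (-s) l k = -signSeq s l k := by
  induction l generalizing s k with
  | nil =>
    rcases Nat.eq_zero_or_pos k with rfl | h
    · rfl
    · rw [signSeq_nil _ h, signSeq_nil _ h, neg_zero]
  | cons a l ih =>
    have ha : 0 < a := hl a (by simp)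
    rcases cons_index_cases (a := a) (k := k) with rfl | ⟨h, h'⟩ | ⟨m, -, rfl⟩
    · rfl
    · rw [signSeq_cons_of_le _ _ h h', signSeq_cons_of_le _ _ h h']
    · rw [signSeq_cons_add _ _ ha, signSeq_cons_add _ _ ha, ih fun x hx => hl x (by simp [hx])]

theorem signSeq_sign {l : List ℕ} (hl : ∀ x ∈ l, 0 < x) {s : ℤ} (hs : s = 1 ∨ s = -1) {k : ℕ}
    (hk : k < 1 + l.sum) : signSeq s l k = 1 ∨ signSeq s l k = -1 := by
  induction l generalizing s k with
  | nil =>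
    obtain rfl : k = 0 := by simpa using hk
    exact hs
  | cons a l ih =>
    have ha : 0 < a := hl a (by simp)
    rcases cons_index_cases (a := a) (k := k) with rfl | ⟨h, h'⟩ | ⟨m, -, rfl⟩
    · exact hs
    · rw [signSeq_cons_of_le _ _ h h']
      omega
    · rw [signSeq_cons_add _ _ ha]
      rw [List.sum_cons] at hk
      exact ih (fun x hx => hl x (by simp [hx])) (by omega) (by omega)

theorem signSeq_tail {l : List ℕ} (hl : ∀ x ∈ l, 0 < x) (s : ℤ) {k : ℕ}
    (hk : 1 + l.sum ≤ k) : signSeq s l k = 0 := by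
  induction l generalizing s k with
  | nil => exact signSeq_nil s (by simp at hk; omega)
  | cons a l ih =>
    have ha : 0 < a := hl a (by simp)
    rw [List.sum_cons] at hk
    obtain ⟨m, rfl⟩ : ∃ m, k = a + m := ⟨k - a, by omega⟩
    rw [signSeq_cons_add _ _ ha]
    exact ih (fun x hx => hl x (by simp [hx])) _ (by omega)

theorem signSeq_sum_take_add {l : List ℕ} (hl : ∀ x ∈ l, 0 < x) (s : ℤ) (m k : ℕ) :
    signSeq s l ((l.take m).sum + k) = signSeq ((-1) ^ min m l.length * s) (l.drop m) k := by
  induction m generalizing l s with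
  | zero => simp
  | succ m ih =>
    cases l with
    | nil => simp
    | cons a l =>
      have ha : 0 < a := hl a (by simp)
      rw [List.take_succ_cons, List.sum_cons, List.drop_succ_cons, add_assoc,
        signSeq_cons_add _ _ ha, ih fun x hx => hl x (by simp [hx])]
      congr 1
      rw [List.length_cons, Nat.add_min_add_right, pow_succ]
      ring

theorem exists_sum_take_or_eq {l : List ℕ} (hl : ∀ x ∈ l, 0 < x) (s : ℤ) {j : ℕ}
    (hj : j ≤ l.sum) : (∃ m ≤ l.length, j = (l.take m).sum) ∨
      0 < j ∧ signSeq s l (j + 1) = signSeq s l j := by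
  induction l generalizing s j with
  | nil => exact Or.inl ⟨0, by simp, by simpa using hj⟩
  | cons a l ih =>
    have ha : 0 < a := hl a (by simp)
    rw [List.sum_cons] at hj
    rcases Nat.lt_or_ge j a with h | h
    · rcases Nat.eq_zero_or_pos j with rfl | h0
      · exact Or.inl ⟨0, by simp, by simp⟩
      · right
        rw [signSeq_cons_of_le _ _ h0 h.le, signSeq_cons_of_le _ _ (by omega) h]
        exact ⟨h0, rfl⟩
    · obtain ⟨i, rfl⟩ := Nat.exists_eq_add_of_le h
      rcases ih (fun x hx => hl x (by simp [hx])) (-s) (j := i) (by omega) with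
        ⟨m, hm, rfl⟩ | ⟨hi, heq⟩
      · exact Or.inl ⟨m + 1, by simpa using hm, by simp⟩
      · right
        rw [add_assoc, signSeq_cons_add _ _ ha, signSeq_cons_add _ _ ha]
        exact ⟨by omega, heq⟩

theorem Al_cons_succ (a : ℕ) (l : List ℕ) (i : ℕ) : Al (a :: l) (i + 1) = -Al l i := by
  simp [Al, pow_succ]

theorem Al_cons_zero (a : ℕ) (l : List ℕ) : Al (a :: l) 0 = a := by simp [Al]

theorem Al_nil (i : ℕ) : Al [] i = 0 := by simp [Al]

theorem lexLt_cons {a b : ℕ} {l l' : List ℕ} (h : lexLt (a :: l) (b :: l')) :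
    a < b ∨ a = b ∧ lexLt l' l := by
  obtain ⟨i, hi, hi'⟩ := h
  cases i with
  | zero =>
    rw [Al_cons_zero, Al_cons_zero] at hi'
    exact Or.inl (by exact_mod_cast hi')
  | succ i =>
    right
    have h0 := hi 0 (by omega)
    rw [Al_cons_zero, Al_cons_zero] at h0
    refine ⟨by exact_mod_cast h0, i, fun j hj => ?_, ?_⟩
    · have := hi (j + 1) (by omega)
      rw [Al_cons_succ, Al_cons_succ] at this
      omega
    · rw [Al_cons_succ, Al_cons_succ] at hi'
      omega

theorem Al_injective {l l' : List ℕ} (hl : ∀ x ∈ l, 0 < x) (hl' : ∀ x ∈ l', 0 < x)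
    (h : Al l = Al l') : l = l' := by
  induction l generalizing l' with
  | nil =>
    cases l' with
    | nil => rfl
    | cons b l' =>
      have h0 := congrFun h 0
      rw [Al_nil, Al_cons_zero] at h0
      have := hl' b (by simp)
      omega
  | cons a l ih =>
    cases l' with
    | nil =>
      have h0 := congrFun h 0
      rw [Al_nil, Al_cons_zero] at h0
      have := hl a (by simp)
      omega
    | cons b l' =>
      have h0 := congrFun h 0
      rw [Al_cons_zero, Al_cons_zero] at h0
      have htl : Al l = Al l' := by
        funext i
        have := congrFun h (i + 1)
        rw [Al_cons_succ, Al_cons_succ] at this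
        omega
      rw [ih (fun x hx => hl x (by simp [hx])) (fun x hx => hl' x (by simp [hx])) htl]
      congr 1
      exact_mod_cast h0

theorem seqLt_signSeq_of_lexLt {l l' : List ℕ} (hl : ∀ x ∈ l, 0 < x) (hl' : ∀ x ∈ l', 0 < x)
    (h : lexLt l l') : SeqLt (signSeq (-1) l) (signSeq (-1) l') := by
  induction hlen : l.length + l'.length using Nat.strong_induction_on generalizing l l' with
  | _ N ih =>
  cases l with
  | nil =>
    cases l' with
    | nil => exact absurd h (SeqLt.irrefl _)
    | cons b l' =>
      refine ⟨1, fun i hi => ?_, ?_⟩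
      · obtain rfl : i = 0 := by omega
        rfl
      · rw [signSeq_nil _ one_pos, signSeq_cons_of_le _ _ one_pos (hl' b (by simp))]
        decide
  | cons a l =>
    have ha : 0 < a := hl a (by simp)
    have hlt : ∀ x ∈ l, 0 < x := fun x hx => hl x (by simp [hx])
    cases l' with
    | nil =>
      obtain ⟨i, hi, hi'⟩ := h
      exfalso
      cases i with
      | zero =>
        rw [Al_nil, Al_cons_zero] at hi'
        omega
      | succ i =>
        have := hi 0 (by omega)
        rw [Al_nil, Al_cons_zero] at this
        omega
    | cons b l' =>
      have hlt' : ∀ x ∈ l', 0 < x := fun x hx => hl' x (by simp [hx])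
      rcases lexLt_cons h with hab | ⟨rfl, htl⟩
      · refine ⟨a + 1, fun i hi => ?_, ?_⟩
        · rcases Nat.eq_zero_or_pos i with rfl | h0
          · rfl
          · rw [signSeq_cons_of_le _ _ h0 (by omega), signSeq_cons_of_le _ _ h0 (by omega)]
        · rw [signSeq_cons_add _ _ ha, signSeq_cons_of_le _ _ (by omega) hab]
          cases l with
          | nil =>
            rw [signSeq_nil _ one_pos]
            decide
          | cons c l =>
            rw [signSeq_cons_of_le _ _ one_pos (hlt c (by simp))]
            decide
      · obtain ⟨k, hk, hk'⟩ := ih (l'.length + l.length) (by simp at hlen; omega) hlt' hlt htl rfl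
        refine ⟨a + k, fun i hi => ?_, ?_⟩
        · rcases cons_index_cases (a := a) (k := i) with rfl | ⟨h, h'⟩ | ⟨m, -, rfl⟩
          · rfl
          · rw [signSeq_cons_of_le _ _ h h', signSeq_cons_of_le _ _ h h']
          · rw [signSeq_cons_add _ _ ha, signSeq_cons_add _ _ ha, signSeq_neg hlt,
              signSeq_neg hlt', hk m (by omega)]
        · rw [signSeq_cons_add _ _ ha, signSeq_cons_add _ _ ha, signSeq_neg hlt,
            signSeq_neg hlt']
          omega

theorem lexLt_iff_seqLt {l l' : List ℕ} (hl : ∀ x ∈ l, 0 < x) (hl' : ∀ x ∈ l', 0 < x) :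
    lexLt l l' ↔ SeqLt (signSeq (-1) l) (signSeq (-1) l') := by
  refine ⟨seqLt_signSeq_of_lexLt hl hl', fun h => ?_⟩
  by_contra hn
  rcases SeqLt.eq_or_lt_of_not_lt hn with h' | h'
  · rw [Al_injective hl hl' h'] at h
    exact SeqLt.irrefl _ h
  · exact h.asymm (seqLt_signSeq_of_lexLt hl' hl h')

theorem normShift_signSeq {l : List ℕ} (hl : ∀ x ∈ l, 0 < x) (m : ℕ) :
    normShift (signSeq (-1) l) (l.take m).sum = signSeq (-1) (l.drop m) := by
  have hd : ∀ x ∈ l.drop m, 0 < x := fun x hx => hl x (List.mem_of_mem_drop hx)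
  funext k
  have h0 := signSeq_sum_take_add hl (-1) m 0
  rw [signSeq_zero, add_zero] at h0
  rw [normShift, signSeq_sum_take_add hl, h0]
  rcases neg_one_pow_eq_or ℤ (min m l.length) with h | h
  · rw [h]
    simp
  · rw [h, signSeq_neg hd 1 k]
    simp

theorem sum_take_pos {l : List ℕ} (hl : ∀ x ∈ l, 0 < x) (hne : l ≠ []) {m : ℕ} (hm : 0 < m) :
    0 < (l.take m).sum := by
  obtain ⟨m, rfl⟩ := Nat.exists_eq_succ_of_ne_zero hm.ne'
  cases l with
  | nil => exact absurd rfl hne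
  | cons a l =>
    have := hl a (by simp)
    simp only [Nat.succ_eq_add_one, List.take_succ_cons, List.sum_cons]
    omega

theorem sum_take_mono (l : List ℕ) {m m' : ℕ} (h : m ≤ m') : (l.take m).sum ≤ (l.take m').sum :=
  (List.take_sublist_take_left h).sum_le_sum (fun _ _ => Nat.zero_le _)

theorem sum_take_le (l : List ℕ) (m : ℕ) : (l.take m).sum ≤ l.sum :=
  (List.take_sublist m l).sum_le_sum (fun _ _ => Nat.zero_le _)

theorem IsLexical.admissible {l : List ℕ} (h : IsLexical l) :
    Admissible (1 + l.sum) (signSeq (-1) l) := by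
  obtain ⟨⟨hne, hl⟩, hlex⟩ := h
  have hone : signSeq (-1) l 1 = 1 := by
    cases l with
    | nil => exact absurd rfl hne
    | cons a l => exact signSeq_cons_of_le _ _ one_pos (hl a (by simp))
  refine ⟨rfl, hone, fun k hk => signSeq_sign hl (Or.inr rfl) hk, fun k hk => signSeq_tail hl _ hk,
    fun j hj0 hj => ?_⟩
  have hjs := signSeq_sign hl (Or.inr rfl) hj
  rcases exists_sum_take_or_eq hl (-1) (j := j) (by omega) with ⟨m, hm, rfl⟩ | ⟨-, heq⟩
  · rw [normShift_signSeq hl, ← lexLt_iff_seqLt (fun x hx => hl x (List.mem_of_mem_drop hx)) hl]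
    rcases hm.lt_or_eq with hm | rfl
    · have hm0 : m ≠ 0 := by
        rintro rfl
        simp at hj0
      simpa using hlex (m + 1) (by omega) hm
    · rw [List.drop_length]
      cases l with
      | nil => exact absurd rfl hne
      | cons a l =>
        refine ⟨0, by simp, ?_⟩
        rw [Al_nil, Al_cons_zero]
        exact_mod_cast hl a (by simp)
  · refine ⟨1, fun i hi => ?_, ?_⟩
    · obtain rfl : i = 0 := by omega
      rw [normShift, add_zero, signSeq_zero]
      rcases hjs with h | h <;> rw [h] <;> rfl
    · rw [normShift, heq, hone]
      rcases hjs with h | h <;> rw [h] <;> decide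

theorem IsAlphaSeq.isLexical {l : List ℕ} (hl : IsAlphaSeq l)
    (h : Admissible (1 + l.sum) (signSeq (-1) l)) : IsLexical l := by
  refine ⟨hl, fun i hi hil => ?_⟩
  rw [lexLt_iff_seqLt (fun x hx => hl.2 x (List.mem_of_mem_drop hx)) hl.2,
    ← normShift_signSeq hl.2]
  have := sum_take_le l (i - 1)
  exact h.shift_lt _ (sum_take_pos hl.2 hl.1 (by omega)) (by omega)

theorem flipFrom_flipFrom (q : ℕ) (X : ℕ → ℤ) : flipFrom q (flipFrom q X) = X := by
  funext k
  unfold flipFrom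
  split <;> simp

theorem signSeq_split {pre : List ℕ} (hpre : ∀ x ∈ pre, 0 < x) {a : ℕ} (ha : 0 < a) (d : List ℕ)
    (hd : ∀ x ∈ d, 0 < x) (s : ℤ) : signSeq s (pre ++ a :: 1 :: d) =
      flipFrom (pre.sum + (a + 1)) (signSeq s (pre ++ (a + 1) :: d)) := by
  funext k
  induction pre generalizing s k with
  | nil =>
    rw [List.sum_nil, zero_add, List.nil_append, List.nil_append]
    rcases Nat.lt_or_ge k (a + 1) with h | h
    · rw [flipFrom_of_lt _ h]
      rcases Nat.eq_zero_or_pos k with rfl | h0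
      · rfl
      · rw [signSeq_cons_of_le _ _ h0 (by omega), signSeq_cons_of_le _ _ h0 (by omega)]
    · rw [flipFrom_of_le _ h]
      obtain ⟨k, rfl⟩ := Nat.exists_eq_add_of_le h
      rw [signSeq_cons_add _ _ (by omega), add_assoc, signSeq_cons_add _ _ ha,
        signSeq_cons_add _ _ one_pos, signSeq_neg hd]
  | cons c pre ih =>
    have hc : 0 < c := hpre c (by simp)
    rw [List.sum_cons, List.cons_append, List.cons_append]
    rcases cons_index_cases (a := c) (k := k) with rfl | ⟨h, h'⟩ | ⟨m, -, rfl⟩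
    · rw [flipFrom_of_lt _ (by omega)]
      rfl
    · rw [flipFrom_of_lt _ (by omega), signSeq_cons_of_le _ _ h h', signSeq_cons_of_le _ _ h h']
    · rw [signSeq_cons_add _ _ hc, ih fun x hx => hpre x (by simp [hx])]
      unfold flipFrom
      rw [signSeq_cons_add _ _ hc]
      simp only [add_assoc, Nat.add_lt_add_iff_left]

theorem ElemOpAt.spec {α β : List ℕ} {i : ℕ} (hα : IsAlphaSeq α) (h : ElemOpAt α i β) :
    IsAlphaSeq β ∧ β.sum = α.sum ∧ i ≤ α.length ∧ 0 < i ∧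
      signSeq (-1) β = flipFrom (α.take i).sum (signSeq (-1) α) := by
  obtain ⟨-, hpos⟩ := hα
  rcases h with ⟨⟨h1, h2, h3⟩, rfl⟩ | ⟨⟨h1, h2, h3⟩, rfl⟩
  · obtain ⟨pre, c, d, rfl, hlen⟩ : ∃ pre c d, α = pre ++ c :: d ∧ i = pre.length + 1 := by
      refine ⟨α.take (i - 1), α[i - 1], α.drop (i - 1 + 1), ?_, ?_⟩
      · rw [← List.drop_eq_getElem_cons, List.take_append_drop]
      · rw [List.length_take]
        omega
    subst hlen
    simp only [Nat.add_sub_cancel, List.getD_append_right _ _ _ _ le_rfl, Nat.sub_self,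
      List.getD_cons_zero] at h3
    obtain ⟨a, rfl⟩ : ∃ a, c = a + 1 := ⟨c - 1, by omega⟩
    have hE : applyEs (pre ++ (a + 1) :: d) (pre.length + 1) = pre ++ a :: 1 :: d := by
      simp [applyEs, List.drop_append]
    rw [hE]
    have hp : ∀ x ∈ pre, 0 < x := fun x hx => hpos x (by simp [hx])
    have hd : ∀ x ∈ d, 0 < x := fun x hx => hpos x (by simp [hx])
    refine ⟨⟨by simp, ?_⟩, by simp; omega, h2, by omega, ?_⟩
    · intro x hx
      simp only [List.mem_append, List.mem_cons] at hx
      rcases hx with hx | rfl | rfl | hx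
      · exact hp x hx
      · omega
      · omega
      · exact hd x hx
    · rw [signSeq_split hp (by omega) d hd]
      congr 1
      simp [List.take_append, List.take_of_length_le]
  · obtain ⟨pre, b, c, d, rfl, hlen⟩ :
        ∃ pre b c d, α = pre ++ b :: c :: d ∧ i = pre.length + 2 := by
      refine ⟨α.take (i - 2), α[i - 2], α[i - 2 + 1], α.drop (i - 2 + 1 + 1), ?_, ?_⟩
      · rw [← List.drop_eq_getElem_cons, ← List.drop_eq_getElem_cons, List.take_append_drop]
      · rw [List.length_take]
        omega
    subst hlen
    obtain rfl : c = 1 := by simpa [List.getD_append_right] using h3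
    have hE : applyEc (pre ++ b :: 1 :: d) (pre.length + 2) = pre ++ (b + 1) :: d := by
      simp [applyEc, List.drop_append]
    rw [hE]
    have hp : ∀ x ∈ pre, 0 < x := fun x hx => hpos x (by simp [hx])
    have hd : ∀ x ∈ d, 0 < x := fun x hx => hpos x (by simp [hx])
    have hb : 0 < b := hpos b (by simp)
    refine ⟨⟨by simp, ?_⟩, by simp; omega, h2, by omega, ?_⟩
    · intro x hx
      simp only [List.mem_append, List.mem_cons] at hx
      rcases hx with hx | rfl | hx
      · exact hp x hx
      · omega
      · exact hd x hx
    · rw [signSeq_split hp hb d hd]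
      have : ((pre ++ b :: 1 :: d).take (pre.length + 2)).sum = pre.sum + (b + 1) := by
        simp [List.take_append, List.take_of_length_le]
      rw [this, flipFrom_flipFrom]

theorem ElemOpAt.unique {α β γ : List ℕ} {i : ℕ} (h : ElemOpAt α i β) (h' : ElemOpAt α i γ) :
    β = γ := by
  rcases h with ⟨⟨-, -, h⟩, rfl⟩ | ⟨⟨-, -, h⟩, rfl⟩ <;>
    rcases h' with ⟨⟨-, -, h'⟩, rfl⟩ | ⟨⟨-, -, h'⟩, rfl⟩ <;> first | rfl | omega

theorem exists_elemOpAt {α : List ℕ} (hα : IsAlphaSeq α) {i : ℕ} (h2 : 2 ≤ i)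
    (hi : i ≤ α.length) : ∃ β, ElemOpAt α i β := by
  have hpos : 0 < α.getD (i - 1) 0 := by
    rw [List.getD_eq_getElem _ _ (by omega)]
    exact hα.2 _ (List.getElem_mem _)
  rcases Nat.lt_or_ge 1 (α.getD (i - 1) 0) with h | h
  · exact ⟨_, Or.inl ⟨⟨by omega, hi, h⟩, rfl⟩⟩
  · exact ⟨_, Or.inr ⟨⟨h2, hi, by omega⟩, rfl⟩⟩

/-- dual adjacency criterion: if `α'` is not of the form `g ⋆ λ`,
then applying the applicable elementary operation at the largest odd index giving
a lexical result yields the adjacent predecessor `α` of `α'` in `L_n`. -/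
theorem stmt_15 (n : ℕ) (hn : 3 ≤ n) (α' : List ℕ) (hα' : α' ∈ Lset n)
    (hnl : ¬ LeastIn (Lset n) α')
    (hnot : ¬ ∃ m g lam, 2 ≤ m ∧ m < n ∧ m ∣ n ∧ g ∈ Lset m ∧
      IsFundamental g ∧ LeastIn (Lset (n / m)) lam ∧ α' = starProd g lam)
    (i : ℕ) (hi : GoodOddIndex α' i) (himax : ∀ j, GoodOddIndex α' j → j ≤ i)
    (α : List ℕ) (hop : ElemOpAt α' i α) :
    α ∈ Lset n ∧ AdjLtIn (Lset n) α α' := by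
  obtain ⟨hlex', hsum'⟩ := hα'
  have hpos' : ∀ x ∈ α', 0 < x := hlex'.1.2
  obtain ⟨hodd, β, hβ, hβlex⟩ := hi
  obtain rfl : β = α := hβ.unique hop
  obtain ⟨hβα, hβsum, hile, hi0, hflip⟩ := hop.spec hlex'.1
  have hX := hlex'.admissible
  have hY := hβlex.admissible
  rw [hβsum, hflip] at hY
  have hXtake : ∀ m ≤ α'.length, signSeq (-1) α' (α'.take m).sum = (-1) ^ m * (-1) := by
    intro m hm
    have := signSeq_sum_take_add hpos' (-1) m 0
    rwa [add_zero, signSeq_zero, min_eq_left hm] at this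
  have hXp : signSeq (-1) α' (α'.take i).sum = 1 := by
    rw [hXtake i hile, hodd.neg_one_pow]
    rfl
  have hp0 : 0 < (α'.take i).sum := sum_take_pos hpos' hlex'.1.1 hi0
  refine ⟨⟨hβlex, by rw [hβsum, hsum']⟩, ?_, ?_⟩
  · rw [lexLt_iff_seqLt hβα.2 hpos', hflip]
    refine ⟨_, fun k hk => flipFrom_of_lt _ hk, ?_⟩
    rw [flipFrom_of_le _ le_rfl, hXp]
    decide
  · rintro γ ⟨hγlex, hγsum⟩ ⟨h1, h2⟩
    have hZ := hγlex.admissible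
    rw [lexLt_iff_seqLt hβα.2 hγlex.1.2, hflip] at h1
    rw [lexLt_iff_seqLt hγlex.1.2 hpos'] at h2
    rw [hγsum, ← hsum'] at hZ
    obtain ⟨q, hpq, hqn, hXq, hXq1, hW⟩ :=
      exists_admissible_flip_of_between hX hY hZ hp0 hXp h1 h2
    rcases exists_sum_take_or_eq hpos' (-1) (j := q) (by omega) with ⟨m, hm, rfl⟩ | ⟨-, heq⟩
    · have him : i < m := by
        by_contra h
        have := sum_take_mono α' (m := m) (m' := i) (by omega)
        omega
      have hmodd : Odd m := by
        by_contra h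
        rw [Nat.not_odd_iff_even] at h
        rw [hXtake m hm, h.neg_one_pow] at hXq
        omega
      obtain ⟨δ, hδ⟩ := exists_elemOpAt hlex'.1 (i := m) (by omega) hm
      obtain ⟨hδα, hδsum, -, -, hδflip⟩ := hδ.spec hlex'.1
      rw [← hδflip, ← hδsum] at hW
      have := himax m ⟨hmodd, δ, hδ, hδα.isLexical hW⟩
      omega
    · rw [heq] at hXq1
      exact hXq1 hXq
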